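/- Let ε₁, ε₂, ε₃, ε₄, a, b be complex numbers with ε₁+ε₂+ε₃+ε₄ = 0, generic so that all sh- and ch-factors below are nonzero, where sh(t) = e^{t/2} − e^{−t/2} and ch(t) = e^{t/2} + e^{−t/2}. Define P = sh(−ε₁−ε₄)·sh(−ε₂−ε₄)·sh(−ε₃−ε₄)/(sh(−ε₁)·sh(−ε₂)·sh(−ε₃)·sh(−ε₄)) and H(φ) = sh(φ−b)·sh(φ−a+ε₄)²·sh(φ−a+ε₁)·sh(φ−a+ε₂)·sh(φ−a+ε₃) / [sh(φ−a−ε₁−ε₂)·sh(φ−a−ε₁−ε₃)·sh(φ−a−ε₂−ε₃)·sh(φ−a−ε₄)]. Then −P · lim_{φ→a} (d/dφ) H(φ) = −(1/2)·ch(b−a) − (3/2)·sh(b−a)·ch(ε₁+ε₂+ε₃)/sh(ε₁+ε₂+ε₃) + (1/2)·sh(b−a)·[ch(ε₁)/sh(ε₁) + ch(ε₂)/sh(ε₂) + ch(ε₃)/sh(ε₃) + ch(ε₁+ε₂)/sh(ε₁+ε₂) + ch(ε₁+ε₃)/sh(ε₁+ε₃) + ch(ε₂+ε₃)/sh(ε₂+ε₃)].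 -/

import Mathlib

open Filter Topology

/-- `sh x = 2 sinh(x/2) = e^{x/2} - e^{-x/2}`. -/
noncomputable def sh (x : ℂ) : ℂ := Complex.exp (x / 2) - Complex.exp (-x / 2)

/-- `ch x = 2 cosh(x/2) = e^{x/2} + e^{-x/2}`. -/
noncomputable def ch (x : ℂ) : ℂ := Complex.exp (x / 2) + Complex.exp (-x / 2)

/-- The standard one-instanton prefactor. -/
noncomputable def pref (ε₁ ε₂ ε₃ ε₄ : ℂ) : ℂ :=
  sh (-ε₁ - ε₄) * sh (-ε₂ - ε₄) * sh (-ε₃ - ε₄) /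
    (sh (-ε₁) * sh (-ε₂) * sh (-ε₃) * sh (-ε₄))

theorem sh_neg (x : ℂ) : sh (-x) = -sh x := by
  simp [sh]

theorem ch_neg (x : ℂ) : ch (-x) = ch x := by
  simp [ch, add_comm]

theorem differentiable_sh : Differentiable ℂ sh := by
  unfold sh
  fun_prop

theorem hasDerivAt_sh (x : ℂ) : HasDerivAt sh (ch x / 2) x := by
  have h₁ := ((hasDerivAt_id x).div_const 2).cexp
  have h₂ := ((hasDerivAt_id x).neg.div_const 2).cexp
  refine (h₁.sub h₂).congr_deriv ?_
  simp only [ch, id, Pi.neg_apply]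
  ring

/-- The derivative at `a` of a translate of `sh`, with the translated argument normalised. -/
theorem hasDerivAt_sh_comp {u : ℂ → ℂ} {a c : ℂ} (hu : HasDerivAt u 1 a) (hc : u a = c) :
    HasDerivAt (fun ψ => sh (u ψ)) (ch c / 2) a := by
  subst hc
  exact ((hasDerivAt_sh (u a)).comp a hu).congr_deriv (mul_one _)

/-- The derivative of a function holomorphic on a neighbourhood of `a` tends to its value at `a`. -/
theorem tendsto_deriv_of_eventually_differentiableAt {f : ℂ → ℂ} {a f' : ℂ}
    (hf : ∀ᶠ z in 𝓝 a, DifferentiableAt ℂ f z) (h : HasDerivAt f f' a) :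
    Tendsto (deriv f) (𝓝[≠] a) (𝓝 f') := by
  have hc := (Complex.analyticAt_iff_eventually_differentiableAt.2 hf).deriv.continuousAt.tendsto
  rw [h.deriv] at hc
  exact hc.mono_left nhdsWithin_le_nhds

/-- The residue at the second-order pole `φ = a` of the three-leg framing node contribution
(the derivative limit), times `-P`, equals the level-one equivariant PT4 vertex
`Z^{PT}_{□□□∅}[1]`. -/
theorem PT4_three_legs_level_one (ε₁ ε₂ ε₃ ε₄ a b : ℂ)
    (hsum : ε₁ + ε₂ + ε₃ + ε₄ = 0)
    (h1 : sh ε₁ ≠ 0) (h2 : sh ε₂ ≠ 0) (h3 : sh ε₃ ≠ 0) (h4 : sh ε₄ ≠ 0)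
    (h12 : sh (ε₁ + ε₂) ≠ 0) (h13 : sh (ε₁ + ε₃) ≠ 0) (h23 : sh (ε₂ + ε₃) ≠ 0)
    (h123 : sh (ε₁ + ε₂ + ε₃) ≠ 0) :
    Tendsto (fun φ : ℂ =>
        -pref ε₁ ε₂ ε₃ ε₄ *
          deriv (fun ψ : ℂ =>
            sh (ψ - b) * sh (ψ - a + ε₄) ^ 2 *
              sh (ψ - a + ε₁) * sh (ψ - a + ε₂) * sh (ψ - a + ε₃) /
              (sh (ψ - a - ε₁ - ε₂) * sh (ψ - a - ε₁ - ε₃) *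
                sh (ψ - a - ε₂ - ε₃) * sh (ψ - a - ε₄))) φ)
      (𝓝[≠] a)
      (𝓝 (-(1 / 2 : ℂ) * ch (b - a)
          - (3 / 2 : ℂ) * sh (b - a) * ch (ε₁ + ε₂ + ε₃) / sh (ε₁ + ε₂ + ε₃)
          + (1 / 2 : ℂ) * sh (b - a) *
              (ch ε₁ / sh ε₁ + ch ε₂ / sh ε₂ + ch ε₃ / sh ε₃ +
                ch (ε₁ + ε₂) / sh (ε₁ + ε₂) + ch (ε₁ + ε₃) / sh (ε₁ + ε₃) +
                ch (ε₂ + ε₃) / sh (ε₂ + ε₃)))) := by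
  obtain rfl : ε₄ = -(ε₁ + ε₂ + ε₃) := by linear_combination hsum
  set N : ℂ → ℂ := fun ψ =>
    sh (ψ - b) * sh (ψ - a + -(ε₁ + ε₂ + ε₃)) ^ 2 *
      sh (ψ - a + ε₁) * sh (ψ - a + ε₂) * sh (ψ - a + ε₃)
  set D : ℂ → ℂ := fun ψ =>
    sh (ψ - a - ε₁ - ε₂) * sh (ψ - a - ε₁ - ε₃) *
      sh (ψ - a - ε₂ - ε₃) * sh (ψ - a - -(ε₁ + ε₂ + ε₃)) with hD
  have hu (c : ℂ) : HasDerivAt (fun ψ => ψ - c) 1 a := (hasDerivAt_id a).sub_const c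
  have dN := (((((hasDerivAt_sh_comp (hu b) (c := -(b - a)) (by ring)).mul
    ((hasDerivAt_sh_comp ((hu a).add_const (-(ε₁ + ε₂ + ε₃))) (c := -(ε₁ + ε₂ + ε₃))
      (by ring)).pow 2)).mul
    (hasDerivAt_sh_comp ((hu a).add_const ε₁) (c := ε₁) (by ring))).mul
    (hasDerivAt_sh_comp ((hu a).add_const ε₂) (c := ε₂) (by ring))).mul
    (hasDerivAt_sh_comp ((hu a).add_const ε₃) (c := ε₃) (by ring)))
  have dD := ((((hasDerivAt_sh_comp (((hu a).sub_const ε₁).sub_const ε₂)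
      (c := -(ε₁ + ε₂)) (by ring)).mul
    (hasDerivAt_sh_comp (((hu a).sub_const ε₁).sub_const ε₃) (c := -(ε₁ + ε₃)) (by ring))).mul
    (hasDerivAt_sh_comp (((hu a).sub_const ε₂).sub_const ε₃) (c := -(ε₂ + ε₃)) (by ring))).mul
    (hasDerivAt_sh_comp ((hu a).sub_const (-(ε₁ + ε₂ + ε₃))) (c := ε₁ + ε₂ + ε₃) (by ring)))
  have e₀ : a - b = -(b - a) := by ring
  have e₁ : 0 - ε₁ - ε₂ = -(ε₁ + ε₂) := by ring
  have e₂ : 0 - ε₁ - ε₃ = -(ε₁ + ε₃) := by ring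
  have e₃ : 0 - ε₂ - ε₃ = -(ε₂ + ε₃) := by ring
  have e₄ : 0 - -(ε₁ + ε₂ + ε₃) = ε₁ + ε₂ + ε₃ := by ring
  have hDa : D a ≠ 0 := by
    simp only [hD, sub_self, e₁, e₂, e₃, e₄, sh_neg]
    simp [h12, h13, h23, h123]
  have sh_diff := differentiable_sh
  have hNd : Differentiable ℂ N := by fun_prop
  have hDd : Differentiable ℂ D := by fun_prop
  have hev : ∀ᶠ z in 𝓝 a, DifferentiableAt ℂ (fun ψ => N ψ / D ψ) z := by
    filter_upwards [hDd.continuous.continuousAt.eventually_ne hDa] with z hz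
    exact (hNd z).div (hDd z) hz
  have lim := (tendsto_deriv_of_eventually_differentiableAt hev (dN.div dD hDa)).const_mul
    (-pref ε₁ ε₂ ε₃ (-(ε₁ + ε₂ + ε₃)))
  convert lim using 2
  have p₁ : -ε₁ - -(ε₁ + ε₂ + ε₃) = ε₂ + ε₃ := by ring
  have p₂ : -ε₂ - -(ε₁ + ε₂ + ε₃) = ε₁ + ε₃ := by ring
  have p₃ : -ε₃ - -(ε₁ + ε₂ + ε₃) = ε₁ + ε₂ := by ring
  simp only [hD, pref, Pi.mul_apply, Pi.pow_apply, e₀, e₁, e₂, e₃, e₄, p₁, p₂, p₃, sub_self, zero_add,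
    sh_neg, ch_neg, neg_neg]
  field_simp
  ring
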